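/- Let k be a field of characteristic zero and (R, Δ) a commutative differential k-algebra with R noetherian and dim_k R, |Δ| < |k|. Suppose Δ-spec R = ⋃_i X_i is a union of locally closed subsets such that each X_i, with the subspace topology, is homeomorphic to Δ_i-spec R_i for some commutative differential k-algebra (R_i, Δ_i) with R_i noetherian and dim_k R_i, |Δ_i| < |k|. Then R satisfies the Δ-Dixmier-Moeglin equivalence if and only if each R_i satisfies the Δ_i-Dixmier-Moeglin equivalence. -/

import Mathlib

universe u

section DifferentialAlgebra

variable (k R : Type u) [Field k] [CommRing R] [Algebra k R]

/-- `I` is a `Δ`-ideal: it is stable under every derivation in `Δ`. -/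
def IsDeltaIdeal (Δ : Set (Derivation k R R)) (I : Ideal R) : Prop :=
  ∀ δ ∈ Δ, ∀ x ∈ I, δ x ∈ I

/-- `P` is a `Δ`-prime ideal: a prime ideal which is a `Δ`-ideal. -/
def IsDeltaPrime (Δ : Set (Derivation k R R)) (P : Ideal R) : Prop :=
  P.IsPrime ∧ IsDeltaIdeal k R Δ P

/-- The `Δ`-core of an ideal `J`: the largest `Δ`-ideal contained in `J`. -/
def deltaCore (Δ : Set (Derivation k R R)) (J : Ideal R) : Ideal R :=
  sSup {I : Ideal R | IsDeltaIdeal k R Δ I ∧ I ≤ J}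

/-- `P` is `Δ`-primitive: it is the `Δ`-core of some maximal ideal. -/
def IsDeltaPrimitive (Δ : Set (Derivation k R R)) (P : Ideal R) : Prop :=
  ∃ M : Ideal R, M.IsMaximal ∧ deltaCore k R Δ M = P

/-- `Δ`-spec `R`: the set of `Δ`-prime ideals, topologized as a subspace of `Spec R`. -/
abbrev DeltaSpec (Δ : Set (Derivation k R R)) : Type u :=
  {P : PrimeSpectrum R // IsDeltaIdeal k R Δ P.asIdeal}

/-- `P` is `Δ`-rational: whenever `a, b ∈ R` with `b ∉ P` are such that the class of `a/b` in
`Frac(R/P)` is killed by all the induced derivations, that class is algebraic over `k`. -/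
def IsDeltaRational (Δ : Set (Derivation k R R)) (P : Ideal R) (hP : P.IsPrime) : Prop :=
  haveI := hP
  ∀ a b : R, b ∉ P → (∀ δ ∈ Δ, δ a * b - a * δ b ∈ P) →
    IsAlgebraic k
      (algebraMap (R ⧸ P) (FractionRing (R ⧸ P)) (Ideal.Quotient.mk P a) /
       algebraMap (R ⧸ P) (FractionRing (R ⧸ P)) (Ideal.Quotient.mk P b))

/-- `P` is `κ`-separable in `Δ`-spec `R`: there is a set `Λ`, of cardinality `< κ`, of `Δ`-prime
ideals properly containing `P`, such that every `Δ`-prime ideal properly containing `P` contains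
a member of `Λ`. -/
def DeltaSeparable (Δ : Set (Derivation k R R)) (κ : Cardinal.{u}) (P : Ideal R) : Prop :=
  ∃ Λ : Set (Ideal R), (∀ Q ∈ Λ, IsDeltaPrime k R Δ Q ∧ P < Q) ∧
    Cardinal.mk Λ < κ ∧
    ∀ Q : Ideal R, IsDeltaPrime k R Δ Q → P < Q → ∃ Q' ∈ Λ, Q' ≤ Q

/-- `R` satisfies the `Δ`-Dixmier–Moeglin equivalence: for every `Δ`-prime ideal `P`, the
conditions "`{P}` is locally closed in `Δ`-spec `R`", "`P` is `Δ`-primitive", and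
"`P` is `Δ`-rational" are equivalent. -/
def DeltaDME (Δ : Set (Derivation k R R)) : Prop :=
  ∀ (P : PrimeSpectrum R) (hP : IsDeltaIdeal k R Δ P.asIdeal),
    (IsLocallyClosed ({⟨P, hP⟩} : Set (DeltaSpec k R Δ)) ↔ IsDeltaPrimitive k R Δ P.asIdeal) ∧
    (IsDeltaPrimitive k R Δ P.asIdeal ↔ IsDeltaRational k R Δ P.asIdeal P.isPrime)

end DifferentialAlgebra

section Topology

open Cardinal Topology

/-- `p` is `κ`-separable: fewer than `κ` proper specializations of `p` suffice to generize every
proper specialization of `p`. -/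
def IsSeparablePoint {T : Type u} [TopologicalSpace T] (κ : Cardinal.{u}) (p : T) : Prop :=
  ∃ Λ : Set T, (∀ q ∈ Λ, p ⤳ q ∧ q ≠ p) ∧ #Λ < κ ∧
    ∀ q, p ⤳ q → q ≠ p → ∃ q' ∈ Λ, q' ⤳ q

theorem Topology.IsEmbedding.isLocallyClosed_singleton_iff {Y T : Type*} [TopologicalSpace Y]
    [TopologicalSpace T] {f : Y → T} (hf : IsEmbedding f) (hr : IsLocallyClosed (Set.range f))
    (q : Y) : IsLocallyClosed {f q} ↔ IsLocallyClosed {q} := by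
  constructor
  · intro h
    have := h.preimage hf.continuous
    rwa [← Set.image_singleton, Set.preimage_image_eq _ hf.injective] at this
  · intro h
    have := h.image hf.isInducing hr
    rwa [Set.image_singleton] at this

theorem isSeparablePoint_iff_of_isEmbedding {Y T : Type u} [TopologicalSpace Y]
    [TopologicalSpace T] {κ : Cardinal.{u}} (hκ : ℵ₀ ≤ κ)
    (hT : ∀ Z : Set T, IsClosed Z → ∃ Λ : Set T, Λ.Finite ∧ Λ ⊆ Z ∧ ∀ z ∈ Z, ∃ q ∈ Λ, q ⤳ z)
    {f : Y → T} (hf : IsEmbedding f) (hr : IsLocallyClosed (Set.range f))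
    (q : Y) : IsSeparablePoint κ (f q) ↔ IsSeparablePoint κ q := by
  obtain ⟨U, C, hU, hC, hUC⟩ := hr
  have mem (y : Y) : f y ∈ U ∩ C := hUC ▸ Set.mem_range_self y
  constructor
  · rintro ⟨Λ, h1, h2, h3⟩
    refine ⟨f ⁻¹' Λ, fun y hy ↦ ?_, (mk_preimage_of_injective f Λ hf.injective).trans_lt h2,
      fun y hy hne ↦ ?_⟩
    · exact ⟨hf.isInducing.specializes_iff.1 (h1 _ hy).1, fun h ↦ (h1 _ hy).2 (h ▸ rfl)⟩
    · obtain ⟨r, hr, hry⟩ := h3 (f y) (hf.isInducing.specializes_iff.2 hy)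
        (fun h ↦ hne (hf.injective h))
      have hrm : r ∈ U ∩ C := ⟨hry.mem_open hU (mem y).1, (h1 r hr).1.mem_closed hC (mem q).2⟩
      rw [← hUC] at hrm
      obtain ⟨z, rfl⟩ := hrm
      exact ⟨z, hr, hf.isInducing.specializes_iff.1 hry⟩
  · rintro ⟨Λ, h1, h2, h3⟩
    obtain ⟨Λ', hfin, hsub, hgen⟩ := hT (closure {f q} ∩ Uᶜ) (isClosed_closure.inter hU.isClosed_compl)
    refine ⟨f '' Λ ∪ Λ', ?_, ?_, fun t ht hne ↦ ?_⟩
    · rintro _ (⟨y, hy, rfl⟩ | hz)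
      · exact ⟨hf.isInducing.specializes_iff.2 (h1 y hy).1, fun h ↦ (h1 y hy).2 (hf.injective h)⟩
      · have := hsub hz
        refine ⟨specializes_iff_mem_closure.2 this.1, ?_⟩
        rintro rfl
        exact this.2 (mem q).1
    · exact (mk_union_le _ _).trans_lt
        (add_lt_of_lt hκ (mk_image_le.trans_lt h2) (hfin.lt_aleph0.trans_le hκ))
    · by_cases htU : t ∈ U
      · have htm : t ∈ U ∩ C := ⟨htU, ht.mem_closed hC (mem q).2⟩
        rw [← hUC] at htm
        obtain ⟨y, rfl⟩ := htm
        obtain ⟨z, hz, hzy⟩ := h3 y (hf.isInducing.specializes_iff.1 ht) (fun h ↦ hne (h ▸ rfl))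
        exact ⟨f z, .inl ⟨z, hz, rfl⟩, hf.isInducing.specializes_iff.2 hzy⟩
      · obtain ⟨z, hz, hzt⟩ := hgen t ⟨specializes_iff_mem_closure.1 ht, htU⟩
        exact ⟨z, .inr hz, hzt⟩

end Topology

section DeltaIdeals

variable {k R : Type u} [Field k] [CommRing R] [Algebra k R] {Δ : Set (Derivation k R R)}

theorem IsDeltaIdeal.sInf {S : Set (Ideal R)} (h : ∀ I ∈ S, IsDeltaIdeal k R Δ I) :
    IsDeltaIdeal k R Δ (sInf S) := fun δ hδ x hx ↦ by
  rw [Submodule.mem_sInf] at hx ⊢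
  exact fun I hI ↦ h I hI δ hδ x (hx I hI)

theorem isDeltaIdeal_deltaCore (J : Ideal R) : IsDeltaIdeal k R Δ (deltaCore k R Δ J) := by
  intro δ hδ x hx
  rw [deltaCore, sSup_eq_iSup'] at hx ⊢
  induction hx using Submodule.iSup_induction' with
  | mem I y hy => exact Submodule.mem_iSup_of_mem I (I.2.1 δ hδ y hy)
  | zero => simp
  | add y z _ _ hy hz => rw [map_add]; exact add_mem hy hz

theorem deltaCore_le (J : Ideal R) : deltaCore k R Δ J ≤ J := sSup_le fun _ h ↦ h.2

theorem le_deltaCore {I J : Ideal R} (hI : IsDeltaIdeal k R Δ I) (h : I ≤ J) :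
    I ≤ deltaCore k R Δ J := le_sSup ⟨hI, h⟩

theorem IsDeltaIdeal.radical [CharZero k] {I : Ideal R} (hI : IsDeltaIdeal k R Δ I) :
    IsDeltaIdeal k R Δ I.radical := by
  rintro δ hδ x ⟨n, hn⟩
  have cancel (m : ℕ) (y : R) (h : ((m + 1 : ℕ) : R) * y ∈ I) : y ∈ I := by
    have h2 : algebraMap k R ((m + 1 : ℕ) : k)⁻¹ * (((m + 1 : ℕ) : R) * y) = y := by
      rw [← mul_assoc, ← map_natCast (algebraMap k R), ← map_mul,
        inv_mul_cancel₀ (Nat.cast_ne_zero.2 m.succ_ne_zero), map_one, one_mul]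
    exact h2 ▸ I.mul_mem_left _ h
  have step (m l : ℕ) (h : x ^ (m + 1) * δ x ^ l ∈ I) : ∃ l', x ^ m * δ x ^ l' ∈ I := by
    refine ⟨l + 2, cancel m _ ?_⟩
    have h1 := I.mul_mem_left (δ x) (hI δ hδ _ h)
    have h2 := I.mul_mem_left (l * δ (δ x)) h
    have h3 : δ x * δ (x ^ (m + 1) * δ x ^ l) =
        ((m + 1 : ℕ) : R) * (x ^ m * δ x ^ (l + 2)) + l * δ (δ x) * (x ^ (m + 1) * δ x ^ l) := by
      rw [Derivation.leibniz, Derivation.leibniz_pow, Derivation.leibniz_pow]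
      simp only [smul_eq_mul, nsmul_eq_mul, Nat.add_sub_cancel]
      cases l with
      | zero => simp; ring
      | succ l => simp only [Nat.add_sub_cancel]; ring
    rw [h3] at h1
    exact (Submodule.add_mem_iff_left _ h2).1 h1
  have descend (m : ℕ) : ∀ l, x ^ m * δ x ^ l ∈ I → δ x ∈ I.radical := by
    induction m with
    | zero => exact fun l hl ↦ ⟨l, by simpa using hl⟩
    | succ m ih => exact fun l hl ↦ (step m l hl).elim ih
  exact descend n 0 (by simpa using hn)

theorem IsDeltaIdeal.colon_singleton {I : Ideal R} (hI : IsDeltaIdeal k R Δ I)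
    (hrad : I.IsRadical) (s : R) :
    IsDeltaIdeal k R Δ (Submodule.comap (LinearMap.mulLeft R s) I) := by
  intro δ hδ x hx
  simp only [Submodule.mem_comap, LinearMap.mulLeft_apply] at hx ⊢
  refine hrad ⟨2, ?_⟩
  have h1 := I.mul_mem_left (s * δ x) (hI δ hδ _ hx)
  have h2 := I.mul_mem_left (δ x * δ s) hx
  have h3 : s * δ x * δ (s * x) = (s * δ x) ^ 2 + δ x * δ s * (s * x) := by
    rw [Derivation.leibniz]; simp only [smul_eq_mul]; ring
  rw [h3] at h1
  exact (Submodule.add_mem_iff_left _ h2).1 h1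

theorem isPrime_deltaCore [CharZero k] {M : Ideal R} (hM : M.IsPrime) :
    (deltaCore k R Δ M).IsPrime := by
  have hI := isDeltaIdeal_deltaCore (k := k) (Δ := Δ) M
  have hle := deltaCore_le (k := k) (Δ := Δ) M
  have hrad : (deltaCore k R Δ M).IsRadical :=
    le_deltaCore hI.radical (hM.radical_le_iff.2 hle)
  refine ⟨fun h ↦ hM.ne_top (top_le_iff.1 (h ▸ hle)), fun {a b} hab ↦ or_iff_not_imp_left.2 fun ha ↦ ?_⟩
  refine le_deltaCore (hI.colon_singleton hrad a) (fun s hs ↦ ?_) hab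
  by_contra hsM
  refine ha (le_deltaCore (hI.colon_singleton hrad s) (fun x hx ↦ ?_)
    (show s * a ∈ deltaCore k R Δ M from (mul_comm s a).symm ▸ (show a * s ∈ _ from hs)))
  exact (hM.mem_or_mem (hle hx)).resolve_left hsM

/-- Above any ideal of a noetherian ring there are finitely many `Δ`-primes below all others. -/
theorem exists_finite_deltaPrimes [CharZero k] [IsNoetherianRing R] (J : Ideal R) :
    ∃ Λ : Set (DeltaSpec k R Δ), Λ.Finite ∧ (∀ Q ∈ Λ, J ≤ Q.1.asIdeal) ∧
      ∀ Q : DeltaSpec k R Δ, J ≤ Q.1.asIdeal → ∃ Q' ∈ Λ, Q'.1.asIdeal ≤ Q.1.asIdeal := by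
  set J' : Ideal R := sInf {I | IsDeltaIdeal k R Δ I ∧ J ≤ I}
  have hJJ' : J ≤ J' := le_sInf fun _ h ↦ h.2
  have hJ' : IsDeltaIdeal k R Δ J' := .sInf fun _ h ↦ h.1
  refine ⟨{Q | Q.1.asIdeal ∈ J'.minimalPrimes}, ?_, fun Q hQ ↦ hJJ'.trans hQ.1.2, fun Q hQ ↦ ?_⟩
  · exact (Ideal.finite_minimalPrimes_of_isNoetherianRing R J').preimage
      (fun _ _ _ _ h ↦ Subtype.ext (PrimeSpectrum.ext h))
  · obtain ⟨p, hp, hpQ⟩ := Ideal.exists_minimalPrimes_le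
      (J := Q.1.asIdeal) (sInf_le ⟨Q.2, hQ⟩ : J' ≤ Q.1.asIdeal)
    have hcore : deltaCore k R Δ p = p := (deltaCore_le p).antisymm
      (hp.2 ⟨isPrime_deltaCore hp.1.1, le_deltaCore hJ' hp.1.2⟩ (deltaCore_le p))
    have hΔp : IsDeltaIdeal k R Δ p := by
      have := isDeltaIdeal_deltaCore (k := k) (Δ := Δ) p
      rwa [hcore] at this
    exact ⟨⟨⟨p, hp.1.1⟩, hΔp⟩, hp, hpQ⟩

theorem deltaSpec_specializes_iff {P Q : DeltaSpec k R Δ} :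
    P ⤳ Q ↔ P.1.asIdeal ≤ Q.1.asIdeal :=
  (subtype_specializes_iff _ _).trans (PrimeSpectrum.le_iff_specializes _ _).symm

theorem exists_finite_generizing_of_isClosed [CharZero k] [IsNoetherianRing R]
    (Z : Set (DeltaSpec k R Δ)) (hZ : IsClosed Z) :
    ∃ Λ : Set (DeltaSpec k R Δ), Λ.Finite ∧ Λ ⊆ Z ∧ ∀ z ∈ Z, ∃ q ∈ Λ, q ⤳ z := by
  obtain ⟨C, hC, rfl⟩ := isClosed_induced_iff.1 hZ
  obtain ⟨I, rfl⟩ := (PrimeSpectrum.isClosed_iff_zeroLocus_ideal C).1 hC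
  obtain ⟨Λ, h1, h2, h3⟩ := exists_finite_deltaPrimes (k := k) (Δ := Δ) I
  refine ⟨Λ, h1, h2, fun z hz ↦ (h3 z hz).imp fun q hq ↦ ⟨hq.1, ?_⟩⟩
  exact deltaSpec_specializes_iff.2 hq.2

end DeltaIdeals

section Constants

open Cardinal

variable {k R K : Type u} [Field k] [CommRing R] [Algebra k R] [Field K] [Algebra k K]
  {Δ : Set (Derivation k R R)} {φ : R →ₐ[k] K}

/-- The `Δ`-constants of `K`, viewed as the fraction field of the image of `φ`. -/
def deltaConstants (Δ : Set (Derivation k R R)) (φ : R →ₐ[k] K) : Subalgebra k K where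
  carrier := {g | ∀ δ ∈ Δ, ∃ u v, φ v ≠ 0 ∧ φ u = g * φ v ∧ φ (δ u) = g * φ (δ v)}
  algebraMap_mem' c δ _ := ⟨algebraMap k R c, 1, by simp, by simp, by simp⟩
  mul_mem' := by
    intro g h hg hh δ hδ
    obtain ⟨u, v, hv, h1, h2⟩ := hg δ hδ
    obtain ⟨u', v', hv', h1', h2'⟩ := hh δ hδ
    refine ⟨u * u', v * v', by simp [hv, hv'], by simp only [map_mul, h1, h1']; ring, ?_⟩
    simp only [Derivation.leibniz, smul_eq_mul, map_add, map_mul, h1, h1', h2, h2']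
    ring
  add_mem' := by
    intro g h hg hh δ hδ
    obtain ⟨u, v, hv, h1, h2⟩ := hg δ hδ
    obtain ⟨u', v', hv', h1', h2'⟩ := hh δ hδ
    refine ⟨u * v' + u' * v, v * v', by simp [hv, hv'], by
      simp only [map_add, map_mul, h1, h1']; ring, ?_⟩
    simp only [Derivation.leibniz, smul_eq_mul, map_add, map_mul, h1, h1', h2, h2']
    ring

theorem div_mem_deltaConstants {a b : R} (hb : φ b ≠ 0)
    (h : ∀ δ ∈ Δ, φ (δ a * b - a * δ b) = 0) : φ a / φ b ∈ deltaConstants Δ φ := fun δ hδ ↦ by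
  refine ⟨a, b, hb, by field_simp, ?_⟩
  have := h δ hδ
  simp only [map_sub, map_mul] at this
  field_simp
  linear_combination this

theorem inv_mem_deltaConstants {g : K} (hg : g ∈ deltaConstants Δ φ) (h0 : g ≠ 0) :
    g⁻¹ ∈ deltaConstants Δ φ := fun δ hδ ↦ by
  obtain ⟨u, v, hv, h1, h2⟩ := hg δ hδ
  exact ⟨v, u, by simp [h1, h0, hv], by rw [h1]; field_simp, by rw [h2]; field_simp⟩

theorem map_derivation_of_mem_deltaConstants
    (hΔ : IsDeltaIdeal k R Δ (RingHom.ker φ)) {g : K} (hg : g ∈ deltaConstants Δ φ)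
    {δ : Derivation k R R} (hδ : δ ∈ Δ) {x y : R} (h : φ x = g * φ y) :
    φ (δ x) = g * φ (δ y) := by
  obtain ⟨u, v, hv, h1, h2⟩ := hg δ hδ
  have h3 : x * v - y * u ∈ RingHom.ker φ := by
    rw [RingHom.mem_ker, map_sub, map_mul, map_mul, h, h1]; ring
  have h4 : φ (δ (x * v - y * u)) = 0 := hΔ δ hδ _ h3
  simp only [map_sub, Derivation.leibniz, smul_eq_mul, map_add, map_mul, h, h1, h2] at h4
  refine mul_right_cancel₀ hv ?_
  linear_combination h4

/-- The ideal of elements of `R` whose image is a multiple of `g` by an element of the image. -/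
def conductorIdeal (φ : R →ₐ[k] K) (g : K) : Ideal R where
  carrier := {x | ∃ y, φ x = g * φ y}
  zero_mem' := ⟨0, by simp⟩
  add_mem' := by
    rintro x x' ⟨y, h⟩ ⟨y', h'⟩
    exact ⟨y + y', by rw [map_add, map_add, h, h', mul_add]⟩
  smul_mem' := by
    rintro r x ⟨y, h⟩
    exact ⟨r * y, by rw [smul_eq_mul, map_mul, map_mul, h]; ring⟩

theorem isDeltaIdeal_conductorIdeal (hΔ : IsDeltaIdeal k R Δ (RingHom.ker φ)) {g : K}
    (hg : g ∈ deltaConstants Δ φ) : IsDeltaIdeal k R Δ (conductorIdeal φ g) := by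
  rintro δ hδ x ⟨y, h⟩
  exact ⟨δ y, map_derivation_of_mem_deltaConstants hΔ hg hδ h⟩

/-- Clearing denominators in `f (r / d)`. -/
theorem exists_map_eq_pow_mul_aeval (f : Polynomial k) (r d : R) :
    ∃ (e : R) (n : ℕ), ∀ (L : Type u) [Field L] [Algebra k L] (ψ : R →ₐ[k] L), ψ d ≠ 0 →
      ψ e = ψ d ^ n * Polynomial.aeval (ψ r / ψ d) f := by
  refine ⟨∑ i ∈ Finset.range (f.natDegree + 1),
    algebraMap k R (f.coeff i) * r ^ i * d ^ (f.natDegree - i), f.natDegree, ?_⟩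
  intro L _ _ ψ hd
  rw [Polynomial.aeval_eq_sum_range, map_sum, Finset.mul_sum]
  refine Finset.sum_congr rfl fun i hi ↦ ?_
  have hi' : i ≤ f.natDegree := Nat.lt_succ_iff.1 (Finset.mem_range.1 hi)
  rw [map_mul, map_mul, map_pow, map_pow, AlgHom.commutes, Algebra.smul_def, div_pow]
  conv_rhs => rw [← Nat.sub_add_cancel hi', pow_add]
  field_simp

theorem exists_inv_sub_notMem [CharZero k] {t : K} (ht : Transcendental k t) (W : Submodule k K)
    (hW : Module.rank k W < #k) : ∃ c : k, c ≠ 0 ∧ (t - algebraMap k K c)⁻¹ ∉ W := by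
  by_contra! H
  have hli := ht.linearIndependent_sub_inv.comp (Subtype.val : {c : k // c ≠ 0} → k)
    Subtype.val_injective
  have hli' : LinearIndependent k
      fun c : {c : k // c ≠ 0} ↦ (⟨(t - algebraMap k K c)⁻¹, H c c.2⟩ : W) :=
    LinearIndependent.of_comp W.subtype hli
  have hcard : #{c : k // c ≠ 0} = #k :=
    mk_compl_of_infinite {(0 : k)} (by
      rw [mk_singleton]; exact one_lt_aleph0.trans_le (aleph0_le_mk k))
  exact (hcard ▸ hli'.cardinal_le_rank).not_gt hW

theorem isAlgebraic_of_rank_lt [CharZero k] (hK : Module.rank k K < #k) (t : K) :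
    IsAlgebraic k t := by
  by_contra ht
  obtain ⟨c, -, hc⟩ := exists_inv_sub_notMem ht ⊤ (by rwa [rank_top])
  exact hc trivial

/-- Constants of the fraction field modulo a `Δ`-primitive ideal are algebraic. -/
theorem isAlgebraic_of_mem_deltaConstants_of_isMaximal [CharZero k]
    (hrank : Module.rank k R < #k) (hfrac : ∀ z : K, ∃ x y, φ y ≠ 0 ∧ φ x = z * φ y)
    {M : Ideal R} (hM : M.IsMaximal) (hcore : deltaCore k R Δ M = RingHom.ker φ)
    {c : K} (hc : c ∈ deltaConstants Δ φ) : IsAlgebraic k c := by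
  have hΔ : IsDeltaIdeal k R Δ (RingHom.ker φ) := hcore ▸ isDeltaIdeal_deltaCore M
  have hkerM : RingHom.ker φ ≤ M := hcore ▸ deltaCore_le M
  have le_ker {g : K} (hg : g ∈ deltaConstants Δ φ) (hle : conductorIdeal φ g ≤ M) :
      conductorIdeal φ g ≤ RingHom.ker φ :=
    hcore ▸ le_deltaCore (isDeltaIdeal_conductorIdeal hΔ hg) hle
  rcases eq_or_ne c 0 with rfl | hc0
  · exact isAlgebraic_zero
  obtain ⟨a, b, hb, hab⟩ := hfrac c
  obtain ⟨d, ⟨r, hr⟩, hdM⟩ : ∃ d ∈ conductorIdeal φ c⁻¹, d ∉ M := by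
    by_contra! H
    exact hb (le_ker (inv_mem_deltaConstants hc hc0) H ⟨a, by rw [hab]; field_simp⟩)
  let _ := Ideal.Quotient.field M
  let ψ : R →ₐ[k] R ⧸ M := Ideal.Quotient.mkₐ k M
  have hψ (x : R) : ψ x = 0 ↔ x ∈ M := Ideal.Quotient.eq_zero_iff_mem
  have hd : φ d ≠ 0 := fun h ↦ hdM (hkerM h)
  have hrd : φ r / φ d = c := by rw [div_eq_iff hd, hr]; field_simp
  have hrankM : Module.rank k (R ⧸ M) < #k :=
    (LinearMap.rank_le_of_surjective ψ.toLinearMap (Ideal.Quotient.mkₐ_surjective k M)).trans_lt hrank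
  obtain ⟨f, hf0, hf⟩ := isAlgebraic_of_rank_lt hrankM (ψ r / ψ d)
  refine ⟨f, hf0, ?_⟩
  obtain ⟨e, n, he⟩ := exists_map_eq_pow_mul_aeval f r d
  have heM : e ∈ M := by
    rw [← hψ, he _ ψ (by rwa [Ne, hψ]), hf, mul_zero]
  have heφ := he _ φ hd
  rw [hrd] at heφ
  have hg : Polynomial.aeval c f ∈ deltaConstants Δ φ :=
    Polynomial.aeval_subalgebra_coe f _ (⟨c, hc⟩ : deltaConstants Δ φ) ▸ Subtype.property _
  have he0 : φ e = 0 := by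
    refine le_ker hg ?_ ⟨d ^ n, by rw [heφ, map_pow, mul_comm]⟩
    rintro x ⟨y, hxy⟩
    have h1 : d ^ n * x - e * y ∈ M := hkerM (by
      rw [RingHom.mem_ker, map_sub, map_mul, map_mul, map_pow, heφ, hxy]; ring)
    have h2 : d ^ n * x ∈ M := by
      have := add_mem h1 (M.mul_mem_right y heM)
      rwa [sub_add_cancel] at this
    exact (hM.isPrime.mem_or_mem h2).resolve_left fun h ↦ hdM (hM.isPrime.mem_of_pow_mem _ h)
  rw [heφ] at he0
  exact (mul_eq_zero.1 he0).resolve_left (pow_ne_zero _ hd)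

/-- Primes of an algebra of dimension less than `#k` are intersections of maximal ideals. -/
theorem exists_isMaximal_notMem [CharZero k] (hrank : Module.rank k R < #k) {f : R}
    (hf : φ f ≠ 0) : ∃ M : Ideal R, M.IsMaximal ∧ RingHom.ker φ ≤ M ∧ f ∉ M := by
  by_contra! H
  have hjac : f ∈ (RingHom.ker φ).jacobson :=
    Submodule.mem_sInf.2 fun M hM ↦ H M hM.2 hM.1
  by_cases halg : IsAlgebraic k (φ f)
  · obtain ⟨M, hM, hle⟩ := Ideal.exists_le_maximal _ (RingHom.ker_ne_top φ)
    have halg' : IsAlgebraic k (⟨φ f, f, rfl⟩ : φ.range) :=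
      (isAlgebraic_algHom_iff φ.range.val Subtype.val_injective).1 halg
    obtain ⟨r, hr0, ⟨_, y, rfl⟩, hy⟩ := halg'.exists_nonzero_dvd
      (mem_nonZeroDivisors_of_ne_zero fun h ↦ hf (congrArg Subtype.val h))
    have hy' : algebraMap k K r = φ f * φ y := congrArg Subtype.val hy
    have h1 : f * y - algebraMap k R r ∈ M := hle (by
      rw [RingHom.mem_ker, map_sub, map_mul, AlgHom.commutes, hy', sub_self])
    have h2 : algebraMap k R r ∈ M := by
      have := sub_mem (M.mul_mem_right y (H M hM hle)) h1
      rwa [sub_sub_cancel] at this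
    exact hM.ne_top (M.eq_top_of_isUnit_mem h2 ((IsUnit.mk0 r hr0).map _))
  · obtain ⟨c, hc0, hc⟩ := exists_inv_sub_notMem halg (LinearMap.range φ.toLinearMap)
      ((rank_range_le _).trans_lt hrank)
    obtain ⟨z, hz⟩ := Ideal.mem_jacobson_iff.1 hjac (algebraMap k R (-c⁻¹))
    rw [RingHom.mem_ker] at hz
    simp only [map_sub, map_add, map_mul, map_one, AlgHom.commutes, map_neg, map_inv₀] at hz
    have hc0' : algebraMap k K c ≠ 0 := by simpa using hc0
    refine hc ⟨algebraMap k R (-c⁻¹) * z, ?_⟩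
    refine eq_inv_of_mul_eq_one_left ?_
    simp only [AlgHom.toLinearMap_apply, map_mul, AlgHom.commutes, map_neg, map_inv₀]
    field_simp at hz ⊢
    linear_combination hz

end Constants

section Separable

open Cardinal

variable {k R K : Type u} [Field k] [CommRing R] [Algebra k R] [Field K] [Algebra k K]
  {Δ : Set (Derivation k R R)} {φ : R →ₐ[k] K}

theorem exists_common_denominator (hfrac : ∀ z : K, ∃ x y, φ y ≠ 0 ∧ φ x = z * φ y)
    (W : Submodule k K) (hW : W.FG) : ∃ d, φ d ≠ 0 ∧ ∀ z ∈ W, ∃ r, φ r = z * φ d := by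
  induction W, hW using Submodule.fg_induction with
  | singleton z =>
    obtain ⟨x, y, hy, h⟩ := hfrac z
    refine ⟨y, hy, fun w hw ↦ ?_⟩
    obtain ⟨c, rfl⟩ := Submodule.mem_span_singleton.1 hw
    exact ⟨c • x, by rw [map_smul, h, smul_mul_assoc]⟩
  | sup W₁ W₂ _ _ h₁ h₂ =>
    obtain ⟨d₁, hd₁, h₁⟩ := h₁
    obtain ⟨d₂, hd₂, h₂⟩ := h₂
    refine ⟨d₁ * d₂, by simp [hd₁, hd₂], fun z hz ↦ ?_⟩
    obtain ⟨z₁, hz₁, z₂, hz₂, rfl⟩ := Submodule.mem_sup.1 hz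
    obtain ⟨r₁, hr₁⟩ := h₁ z₁ hz₁
    obtain ⟨r₂, hr₂⟩ := h₂ z₂ hz₂
    exact ⟨r₁ * d₂ + r₂ * d₁, by simp only [map_add, map_mul, hr₁, hr₂]; ring⟩

/-- The elements of a finite-dimensional `V` that are constant multiples of `e` generate `Δ`-ideals
sharing an element outside the kernel. -/
theorem exists_mem_of_div_mem_deltaConstants
    (hfrac : ∀ z : K, ∃ x y, φ y ≠ 0 ∧ φ x = z * φ y)
    (halg : ∀ c ∈ deltaConstants Δ φ, IsAlgebraic k c) (V : Submodule k R)
    [FiniteDimensional k V] {e : R} (he : φ e ≠ 0) :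
    ∃ y, φ y ≠ 0 ∧ ∀ I : Ideal R, RingHom.ker φ ≤ I → ∀ x ∈ I, x ∈ V → φ x ≠ 0 →
      φ x / φ e ∈ deltaConstants Δ φ → y ∈ I := by
  let ψ : R →ₗ[k] K := (LinearMap.mulRight k (φ e)⁻¹).comp φ.toLinearMap
  have hψ (x : R) : ψ x = φ x / φ e := (div_eq_mul_inv _ _).symm
  let W : Submodule k K := V.map ψ ⊓ Subalgebra.toSubmodule (deltaConstants Δ φ)
  obtain ⟨s, hs⟩ : W.FG := IsNoetherian.noetherian
    (W.comap (V.map ψ).subtype) |>.map (V.map ψ).subtype |> fun h ↦ by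
      rwa [Submodule.map_comap_subtype, inf_eq_right.2 inf_le_left] at h
  let F := IntermediateField.adjoin k (s : Set K)
  have hsW : ∀ z ∈ s, z ∈ W := fun z hz ↦ hs ▸ Submodule.subset_span hz
  have : FiniteDimensional k F := IntermediateField.finiteDimensional_adjoin
    fun z hz ↦ (halg z (hsW z hz).2).isIntegral
  have hWF : W ≤ Subalgebra.toSubmodule F.toSubalgebra :=
    hs ▸ Submodule.span_le.2 (IntermediateField.subset_adjoin k _)
  obtain ⟨d, hd, hdF⟩ := exists_common_denominator hfrac (Subalgebra.toSubmodule F.toSubalgebra)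
    (Module.Finite.iff_fg.1 this)
  refine ⟨d * e, by simp [hd, he], fun I hI x hxI hxV hx hc ↦ ?_⟩
  have hxF : φ x / φ e ∈ F := hWF ⟨⟨x, hxV, hψ x⟩, hc⟩
  obtain ⟨r, hr⟩ := hdF _ (F.inv_mem hxF)
  have h1 : d * e - r * x ∈ I := hI (by
    rw [RingHom.mem_ker, map_sub, map_mul, map_mul, hr]; field_simp; ring)
  have := add_mem h1 (I.mul_mem_left r hxI)
  rwa [sub_add_cancel] at this

/-- If constants are algebraic, all `Δ`-ideals meeting a finite-dimensional subspace outside the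
kernel of `φ` share an element outside that kernel. -/
theorem exists_mem_of_finiteDimensional
    (hfrac : ∀ z : K, ∃ x y, φ y ≠ 0 ∧ φ x = z * φ y)
    (halg : ∀ c ∈ deltaConstants Δ φ, IsAlgebraic k c) (n : ℕ) (V : Submodule k R)
    [FiniteDimensional k V] (hn : Module.finrank k V ≤ n) :
    ∃ y, φ y ≠ 0 ∧ ∀ I : Ideal R, IsDeltaIdeal k R Δ I → RingHom.ker φ ≤ I →
      ∀ x ∈ I, x ∈ V → φ x ≠ 0 → y ∈ I := by
  induction n generalizing V with
  | zero =>
    have hV : V = ⊥ := Submodule.finrank_eq_zero.1 (Nat.le_zero.1 hn)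
    subst hV
    refine ⟨1, by simp, fun I _ _ x _ hxV hx ↦ absurd ?_ hx⟩
    rw [(Submodule.mem_bot k).1 hxV, map_zero]
  | succ n ih =>
    by_cases hV : ∀ x ∈ V, φ x = 0
    · exact ⟨1, by simp, fun I _ _ x _ hxV hx ↦ absurd (hV x hxV) hx⟩
    push Not at hV
    obtain ⟨e, heV, he⟩ := hV
    let L (δ : Derivation k R R) : R →ₗ[k] R :=
      (LinearMap.mulLeft k e).comp δ.toLinearMap - LinearMap.mulLeft k (δ e)
    have hL (δ : Derivation k R R) (x : R) : L δ x = e * δ x - δ e * x := rfl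
    have hfin (δ : Derivation k R R) : Module.finrank k (V.map (L δ)) ≤ n := by
      have h1 := LinearMap.finrank_range_add_finrank_ker ((L δ).comp V.subtype)
      rw [LinearMap.range_comp, Submodule.range_subtype] at h1
      have h2 : 0 < Module.finrank k (LinearMap.ker ((L δ).comp V.subtype)) := by
        let z : LinearMap.ker ((L δ).comp V.subtype) :=
          ⟨⟨e, heV⟩, LinearMap.mem_ker.2 ((hL δ e).trans (by ring))⟩
        refine (Module.finrank_pos_iff_exists_ne_zero (R := k)).2 ⟨z, fun h ↦ he ?_⟩
        have : e = 0 := congrArg Subtype.val (congrArg Subtype.val h)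
        rw [this, map_zero]
      omega
    choose y hy hyI using fun δ ↦ ih (V.map (L δ)) (hfin δ)
    obtain ⟨y₀, hy₀, hy₀I⟩ := exists_mem_of_div_mem_deltaConstants hfrac halg V he
    let f (δ : Δ) : Submodule k V := LinearMap.ker (φ.toLinearMap.comp ((L δ).comp V.subtype))
    obtain ⟨t, ht⟩ := Finset.exists_inf_le f
    refine ⟨y₀ * ∏ δ ∈ t, y δ, ?_, fun I hI hle x hxI hxV hx ↦ ?_⟩
    · rw [map_mul, map_prod]
      exact mul_ne_zero hy₀ (Finset.prod_ne_zero_iff.2 fun δ _ ↦ hy δ)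
    by_cases hxt : ∀ δ ∈ t, φ (L δ x) = 0
    · refine I.mul_mem_right _ (hy₀I I hle x hxI hxV hx (div_mem_deltaConstants he fun δ hδ ↦ ?_))
      have h1 : (⟨x, hxV⟩ : V) ∈ t.inf f :=
        Submodule.mem_finsetInf.2 fun δ hδ ↦ hxt δ hδ
      have h2 : φ (L δ x) = 0 := ht ⟨δ, hδ⟩ h1
      rw [← h2, hL]
      simp only [map_sub, map_mul]
      ring
    · push Not at hxt
      obtain ⟨δ, hδ, hne⟩ := hxt
      refine I.mul_mem_left _ (I.mem_of_dvd (Finset.dvd_prod_of_mem _ hδ) ?_)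
      refine hyI δ I hI hle (L δ x) ?_ ⟨x, hxV, rfl⟩ hne
      exact sub_mem (I.mul_mem_left _ (hI δ δ.2 x hxI)) (I.mul_mem_left _ hxI)

theorem isSeparablePoint_of_isAlgebraic [CharZero k] [IsNoetherianRing R]
    (hrank : Module.rank k R < #k) (hfrac : ∀ z : K, ∃ x y, φ y ≠ 0 ∧ φ x = z * φ y)
    (halg : ∀ c ∈ deltaConstants Δ φ, IsAlgebraic k c) (P : DeltaSpec k R Δ)
    (hP : P.1.asIdeal = RingHom.ker φ) : IsSeparablePoint #k P := by
  have hk : ℵ₀ ≤ #k := aleph0_le_mk k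
  let B := Module.Basis.ofVectorSpace k R
  let ι := Module.Basis.ofVectorSpaceIndex k R
  have hι : #(Finset ι) < #k := by
    have h1 : #ι < #k := B.mk_eq_rank''.trans_lt hrank
    cases finite_or_infinite ι
    · exact (lt_aleph0_of_finite _).trans_le hk
    · rwa [mk_finset_of_infinite]
  have hfd (s : Finset ι) : FiniteDimensional k (Submodule.span k (B '' s)) :=
    FiniteDimensional.span_of_finite k (s.finite_toSet.image B)
  choose y hy hyI using fun s : Finset ι ↦ exists_mem_of_finiteDimensional hfrac halg _
    (Submodule.span k (B '' s)) le_rfl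
  choose Λ hfin hle hgen using fun s : Finset ι ↦ exists_finite_deltaPrimes (k := k) (Δ := Δ)
    (Ideal.span {y s} ⊔ RingHom.ker φ)
  refine ⟨⋃ s, Λ s, ?_, ?_, fun Q hQ hne ↦ ?_⟩
  · intro Q hQ
    obtain ⟨s, hs⟩ := Set.mem_iUnion.1 hQ
    refine ⟨deltaSpec_specializes_iff.2 (hP ▸ le_sup_right.trans (hle s Q hs)), ?_⟩
    rintro rfl
    have : y s ∈ Q.1.asIdeal := hle s Q hs (Ideal.mem_sup_left (Ideal.mem_span_singleton_self _))
    rw [hP] at this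
    exact hy s this
  · rcases hk.eq_or_lt with hk | hk
    · rw [← hk, lt_aleph0_iff_finite] at hι
      exact (Set.finite_iUnion hfin).lt_aleph0.trans_eq hk
    · exact (mk_iUnion_le _).trans_lt (mul_lt_of_lt hk.le hι
        ((ciSup_le' fun s ↦ (hfin s).lt_aleph0.le).trans_lt hk))
  · rw [deltaSpec_specializes_iff] at hQ
    obtain ⟨x, hxQ, hxP⟩ := SetLike.exists_of_lt (lt_of_le_of_ne hQ fun h ↦
      hne (Subtype.ext (PrimeSpectrum.ext h.symm)))
    obtain ⟨s, hs⟩ : ∃ s : Finset ι, x ∈ Submodule.span k (B '' s) :=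
      ⟨(B.repr x).support, B.mem_span_repr_support x⟩
    have hys : y s ∈ Q.1.asIdeal := hyI s _ Q.2 (hP ▸ hQ) x hxQ hs (by rwa [hP] at hxP)
    obtain ⟨Q', hQ', hQ'Q⟩ := hgen s Q
      (sup_le ((Ideal.span_singleton_le_iff_mem _).2 hys) (hP ▸ hQ))
    exact ⟨Q', Set.mem_iUnion.2 ⟨s, hQ'⟩, deltaSpec_specializes_iff.2 hQ'Q⟩

theorem isAlgebraic_of_isSeparablePoint [CharZero k]
    (hrank : Module.rank k R < #k) (hfrac : ∀ z : K, ∃ x y, φ y ≠ 0 ∧ φ x = z * φ y)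
    (P : DeltaSpec k R Δ) (hP : P.1.asIdeal = RingHom.ker φ) (hsep : IsSeparablePoint #k P)
    {c : K} (hc : c ∈ deltaConstants Δ φ) : IsAlgebraic k c := by
  have hΔ : IsDeltaIdeal k R Δ (RingHom.ker φ) := hP ▸ P.2
  rcases (aleph0_le_mk k).eq_or_lt with hk | hk
  · have : FiniteDimensional k R := Module.rank_lt_aleph0_iff.1 (hk ▸ hrank)
    have halg (x : R) : IsAlgebraic k (φ x) :=
      ((Algebra.IsIntegral.isIntegral (R := k) x).map φ).isAlgebraic
    obtain ⟨x, y, hy, h⟩ := hfrac c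
    rw [eq_div_of_mul_eq hy h.symm, div_eq_mul_inv]
    exact (halg x).mul (halg y).inv
  by_contra htrans
  obtain ⟨Λ, hΛ, hΛk, hgen⟩ := hsep
  have hex (Q : Λ) : ∃ x ∈ Q.1.1.asIdeal, φ x ≠ 0 := by
    by_contra! H
    exact (hΛ Q Q.2).2 (Subtype.ext (PrimeSpectrum.ext (le_antisymm (hP ▸ H)
      (deltaSpec_specializes_iff.1 (hΛ Q Q.2).1))))
  choose x hxQ hx using hex
  let S : Submonoid R := Submonoid.closure (Set.range x)
  have hS (s : R) (hs : s ∈ S) : φ s ≠ 0 := by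
    have : S ≤ (nonZeroDivisors K).comap φ :=
      Submonoid.closure_le.2 (Set.range_subset_iff.2 fun Q ↦
        mem_nonZeroDivisors_of_ne_zero (hx Q))
    exact nonZeroDivisors.ne_zero (this hs)
  have hScard : #S < #k := by
    have h1 : (S : Set R) ⊆ Set.range fun l : List Λ ↦ (l.map x).prod := fun s hs ↦ by
      rw [Set.mem_range]
      induction hs using Submonoid.closure_induction with
      | mem _ h => exact h.elim fun Q hQ ↦ ⟨[Q], by simpa using hQ⟩
      | one => exact ⟨[], rfl⟩
      | mul _ _ _ _ h h' =>
        obtain ⟨l, rfl⟩ := h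
        obtain ⟨l', rfl⟩ := h'
        exact ⟨l ++ l', by simp⟩
    exact (mk_le_mk_of_subset h1).trans_lt (mk_range_le.trans_lt
      ((mk_list_le_max Λ).trans_lt (max_lt hk hΛk)))
  let B := Module.Basis.ofVectorSpace k R
  let W : Submodule k K := Submodule.span k (Set.range fun p : _ × S ↦ φ (B p.1) * (φ p.2)⁻¹)
  have hW (r s : R) (hs : s ∈ S) : φ r * (φ s)⁻¹ ∈ W := by
    have : ⊤ ≤ W.comap ((LinearMap.mulRight k (φ s)⁻¹).comp φ.toLinearMap) := by
      rw [← B.span_eq, Submodule.span_le]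
      rintro _ ⟨i, rfl⟩
      exact Submodule.subset_span ⟨(i, ⟨s, hs⟩), rfl⟩
    exact this (Submodule.mem_top (x := r))
  have hWrank : Module.rank k W < #k := by
    refine (rank_span_le _).trans_lt (mk_range_le.trans_lt ?_)
    rw [mk_prod, lift_id, lift_id, B.mk_eq_rank'']
    exact mul_lt_of_lt hk.le hrank hScard
  obtain ⟨t, -, ht⟩ := exists_inv_sub_notMem htrans W hWrank
  set g := c - algebraMap k K t with hg_def
  have hg0 : g ≠ 0 := fun h ↦ htrans (sub_eq_zero.1 h ▸ isAlgebraic_algebraMap t)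
  have hg : g ∈ deltaConstants Δ φ := sub_mem hc (Subalgebra.algebraMap_mem _ t)
  let J : Ideal R :=
    { carrier := {y | ∃ s ∈ S, y * s ∈ conductorIdeal φ g}
      zero_mem' := ⟨1, S.one_mem, by simp⟩
      add_mem' := by
        rintro y y' ⟨s, hs, h⟩ ⟨s', hs', h'⟩
        refine ⟨s * s', S.mul_mem hs hs', ?_⟩
        have := add_mem (Ideal.mul_mem_right s' _ h) (Ideal.mul_mem_right s _ h')
        convert this using 1
        ring
      smul_mem' := by
        rintro r y ⟨s, hs, h⟩
        refine ⟨s, hs, ?_⟩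
        rw [smul_eq_mul, mul_assoc]
        exact Ideal.mul_mem_left _ r h }
  have hJΔ : IsDeltaIdeal k R Δ J := by
    rintro δ hδ y ⟨s, hs, h⟩
    refine ⟨s * s, S.mul_mem hs hs, ?_⟩
    have h1 := sub_mem (Ideal.mul_mem_left _ s (isDeltaIdeal_conductorIdeal hΔ hg δ hδ _ h))
      (Ideal.mul_mem_left _ (δ s) h)
    convert h1 using 1
    rw [Derivation.leibniz, smul_eq_mul, smul_eq_mul]
    ring
  have hJS : Disjoint (J : Set R) S := by
    refine Set.disjoint_left.2 ?_
    rintro y ⟨s, hs, r, h⟩ hy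
    refine ht ?_
    have hne := hS _ (S.mul_mem hy hs)
    have : g⁻¹ = φ r * (φ (y * s))⁻¹ := by
      field_simp
      rw [h, mul_comm]
    rw [this]
    exact hW r _ (S.mul_mem hy hs)
  obtain ⟨Q, hQ, hJQ, hQS⟩ := Ideal.exists_le_prime_disjoint J S hJS
  let Q' : DeltaSpec k R Δ := ⟨⟨deltaCore k R Δ Q, isPrime_deltaCore hQ⟩, isDeltaIdeal_deltaCore Q⟩
  have hJQ' : J ≤ Q'.1.asIdeal := le_deltaCore hJΔ hJQ
  have hPQ' : P ⤳ Q' := deltaSpec_specializes_iff.2 fun y hy ↦ hJQ' ⟨1, S.one_mem, 0, by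
    rw [hP, RingHom.mem_ker] at hy
    simp [hy]⟩
  have hne : Q' ≠ P := by
    intro h
    obtain ⟨y, z, hz, hyz⟩ := hfrac g
    have hy : y ∈ P.1.asIdeal := h ▸ hJQ' ⟨1, S.one_mem, z, by rwa [mul_one]⟩
    rw [hP, RingHom.mem_ker, hyz] at hy
    exact mul_ne_zero hg0 hz hy
  obtain ⟨q, hq, hqQ'⟩ := hgen Q' hPQ' hne
  exact Set.disjoint_left.1 hQS
    (deltaCore_le Q (deltaSpec_specializes_iff.1 hqQ' (hxQ ⟨q, hq⟩)))
    (Submonoid.subset_closure ⟨⟨q, hq⟩, rfl⟩)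

end Separable

section DixmierMoeglin

open Cardinal

variable {k R : Type u} [Field k] [CommRing R] [Algebra k R] {Δ : Set (Derivation k R R)}

/-- The map from `R` to the fraction field of `R ⧸ P`. -/
noncomputable def toFractionField (k : Type u) {R : Type u} [Field k] [CommRing R] [Algebra k R]
    (P : Ideal R) [P.IsPrime] : R →ₐ[k] FractionRing (R ⧸ P) :=
  (IsScalarTower.toAlgHom k (R ⧸ P) (FractionRing (R ⧸ P))).comp (Ideal.Quotient.mkₐ k P)

theorem ker_toFractionField (P : Ideal R) [P.IsPrime] :
    RingHom.ker (toFractionField k P) = P := by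
  ext x
  rw [RingHom.mem_ker, ← Ideal.Quotient.eq_zero_iff_mem]
  exact (FaithfulSMul.algebraMap_injective (R ⧸ P) (FractionRing (R ⧸ P))).eq_iff' (map_zero _)

theorem exists_toFractionField_eq_mul (P : Ideal R) [P.IsPrime] (z : FractionRing (R ⧸ P)) :
    ∃ x y, toFractionField k P y ≠ 0 ∧ toFractionField k P x = z * toFractionField k P y := by
  obtain ⟨a, b, hb, rfl⟩ := IsFractionRing.div_surjective (R ⧸ P) z
  obtain ⟨x, rfl⟩ := Ideal.Quotient.mk_surjective a
  obtain ⟨y, rfl⟩ := Ideal.Quotient.mk_surjective b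
  have hy : toFractionField k P y ≠ 0 :=
    IsFractionRing.to_map_ne_zero_of_mem_nonZeroDivisors (R := R ⧸ P) hb
  exact ⟨x, y, hy, (div_mul_cancel₀ _ hy).symm⟩

theorem isDeltaRational_iff (P : Ideal R) [hP : P.IsPrime] (hΔ : IsDeltaIdeal k R Δ P) :
    IsDeltaRational k R Δ P hP ↔
      ∀ c ∈ deltaConstants Δ (toFractionField k P), IsAlgebraic k c := by
  have hker (x : R) : toFractionField k P x = 0 ↔ x ∈ P := by
    rw [← RingHom.mem_ker, ker_toFractionField]
  constructor
  · intro h c hc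
    obtain ⟨a, b, hb, hab⟩ := exists_toFractionField_eq_mul (k := k) P c
    rw [eq_div_of_mul_eq hb hab.symm]
    refine h a b (by rwa [Ne, hker] at hb) fun δ hδ ↦ ?_
    have h1 := map_derivation_of_mem_deltaConstants (by rwa [ker_toFractionField]) hc hδ hab
    rw [← hker, map_sub, map_mul, map_mul, h1, hab]
    ring
  · intro h a b hb hab
    exact h _ (div_mem_deltaConstants (by rwa [Ne, hker]) fun δ hδ ↦ (hker _).2 (hab δ hδ))

theorem IsDeltaPrimitive.isDeltaRational [CharZero k] (hrank : Module.rank k R < #k)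
    {P : Ideal R} [hP : P.IsPrime] (h : IsDeltaPrimitive k R Δ P) :
    IsDeltaRational k R Δ P hP := by
  obtain ⟨M, hM, hcore⟩ := h
  rw [isDeltaRational_iff P (by rw [← hcore]; exact isDeltaIdeal_deltaCore M)]
  intro c hc
  exact isAlgebraic_of_mem_deltaConstants_of_isMaximal hrank (exists_toFractionField_eq_mul P) hM
    (hcore.trans (ker_toFractionField P).symm) hc

theorem isDeltaPrimitive_of_isLocallyClosed [CharZero k] (hrank : Module.rank k R < #k)
    {P : DeltaSpec k R Δ} (h : IsLocallyClosed {P}) : IsDeltaPrimitive k R Δ P.1.asIdeal := by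
  obtain ⟨U, C, hU, hC, hUC⟩ := h
  have hPUC : P ∈ U ∩ C := hUC ▸ Set.mem_singleton P
  obtain ⟨Z, hZ, hZU⟩ := isClosed_induced_iff.1 hU.isClosed_compl
  obtain ⟨I, rfl⟩ := (PrimeSpectrum.isClosed_iff_zeroLocus_ideal Z).1 hZ
  have hU' (Q : DeltaSpec k R Δ) : Q ∈ U ↔ ¬ I ≤ Q.1.asIdeal := by
    rw [← not_iff_not, not_not, ← Set.mem_compl_iff, ← hZU]
    rfl
  obtain ⟨f, hfI, hfP⟩ := SetLike.not_le_iff_exists.1 ((hU' P).1 hPUC.1)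
  have hker := ker_toFractionField (k := k) P.1.asIdeal
  obtain ⟨M, hM, hPM, hfM⟩ := exists_isMaximal_notMem (φ := toFractionField k P.1.asIdeal)
    hrank (by rwa [Ne, ← RingHom.mem_ker, hker])
  rw [hker] at hPM
  let Q : DeltaSpec k R Δ :=
    ⟨⟨deltaCore k R Δ M, isPrime_deltaCore hM.isPrime⟩, isDeltaIdeal_deltaCore M⟩
  have hPQ : P ⤳ Q := deltaSpec_specializes_iff.2 (le_deltaCore P.2 hPM)
  have hQ : Q ∈ U ∩ C :=
    ⟨(hU' Q).2 fun h ↦ hfM (deltaCore_le M (h hfI)), hPQ.mem_closed hC hPUC.2⟩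
  rw [← hUC, Set.mem_singleton_iff] at hQ
  exact ⟨M, hM, congrArg (fun Q : DeltaSpec k R Δ ↦ Q.1.asIdeal) hQ⟩

theorem isDeltaRational_iff_isSeparablePoint [CharZero k] [IsNoetherianRing R]
    (hrank : Module.rank k R < #k) (P : DeltaSpec k R Δ) :
    IsDeltaRational k R Δ P.1.asIdeal P.1.isPrime ↔ IsSeparablePoint #k P := by
  have hker := (ker_toFractionField (k := k) P.1.asIdeal).symm
  have hfrac := exists_toFractionField_eq_mul (k := k) P.1.asIdeal
  rw [isDeltaRational_iff _ P.2]
  exact ⟨fun h ↦ isSeparablePoint_of_isAlgebraic hrank hfrac h P hker,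
    fun h _ hc ↦ isAlgebraic_of_isSeparablePoint hrank hfrac P hker h hc⟩

/-- The `Δ`-Dixmier–Moeglin equivalence is a topological property of `Δ`-spec `R`. -/
theorem deltaDME_iff_forall_isSeparablePoint [CharZero k] [IsNoetherianRing R]
    (hrank : Module.rank k R < #k) :
    DeltaDME k R Δ ↔ ∀ P : DeltaSpec k R Δ, IsSeparablePoint #k P → IsLocallyClosed {P} := by
  constructor
  · intro h P hP
    exact (h P.1 P.2).1.2 ((h P.1 P.2).2.2 ((isDeltaRational_iff_isSeparablePoint hrank P).2 hP))
  · intro h P hP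
    have h1 := isDeltaPrimitive_of_isLocallyClosed hrank (P := (⟨P, hP⟩ : DeltaSpec k R Δ))
    have h2 : IsDeltaPrimitive k R Δ P.asIdeal → IsDeltaRational k R Δ P.asIdeal P.isPrime :=
      IsDeltaPrimitive.isDeltaRational hrank
    have h3 : IsDeltaRational k R Δ P.asIdeal P.isPrime →
        IsLocallyClosed ({⟨P, hP⟩} : Set (DeltaSpec k R Δ)) :=
      fun hr ↦ h _ ((isDeltaRational_iff_isSeparablePoint hrank ⟨P, hP⟩).1 hr)
    exact ⟨⟨h1, h3 ∘ h2⟩, h2, h1 ∘ h3⟩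

end DixmierMoeglin

/-- If `Δ`-spec `R` is covered by locally closed subsets each homeomorphic to the `Δᵢ`-spectrum of
a noetherian commutative differential `k`-algebra `Rᵢ` (with the relevant dimensions and
cardinalities `< |k|`), then `R` satisfies the `Δ`-Dixmier–Moeglin equivalence iff each `Rᵢ`
satisfies the `Δᵢ`-Dixmier–Moeglin equivalence. -/
theorem deltaDME_iff_of_stratification (k R : Type u) [Field k] [CharZero k]
    [CommRing R] [Algebra k R] [IsNoetherianRing R]
    (hrank : Module.rank k R < Cardinal.mk k)
    (Δ : Set (Derivation k R R)) (hΔ : Cardinal.mk Δ < Cardinal.mk k)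
    (ι : Type u) (Ri : ι → Type u) [∀ i, CommRing (Ri i)] [∀ i, Algebra k (Ri i)]
    [∀ i, IsNoetherianRing (Ri i)]
    (Δi : ∀ i, Set (Derivation k (Ri i) (Ri i)))
    (hranki : ∀ i, Module.rank k (Ri i) < Cardinal.mk k)
    (hΔi : ∀ i, Cardinal.mk (Δi i) < Cardinal.mk k)
    (X : ι → Set (DeltaSpec k R Δ))
    (hcover : (⋃ i, X i) = Set.univ)
    (hlc : ∀ i, IsLocallyClosed (X i))
    (hhomeo : ∀ i, Nonempty (X i ≃ₜ DeltaSpec k (Ri i) (Δi i))) :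
    DeltaDME k R Δ ↔ ∀ i, DeltaDME k (Ri i) (Δi i) := by
  have hκ := Cardinal.aleph0_le_mk k
  have hT := exists_finite_generizing_of_isClosed (k := k) (R := R) (Δ := Δ)
  let e (i : ι) : X i ≃ₜ DeltaSpec k (Ri i) (Δi i) := (hhomeo i).some
  let f (i : ι) : DeltaSpec k (Ri i) (Δi i) → DeltaSpec k R Δ := Subtype.val ∘ (e i).symm
  have hf (i : ι) : Topology.IsEmbedding (f i) :=
    Topology.IsEmbedding.subtypeVal.comp (e i).symm.isEmbedding
  have hrange (i : ι) : Set.range (f i) = X i := by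
    rw [(e i).symm.surjective.range_comp, Subtype.range_val]
  have hr (i : ι) : IsLocallyClosed (Set.range (f i)) := (hrange i).symm ▸ hlc i
  simp only [deltaDME_iff_forall_isSeparablePoint hrank,
    fun i ↦ deltaDME_iff_forall_isSeparablePoint (Δ := Δi i) (hranki i)]
  constructor
  · intro h i q hq
    rw [← (hf i).isLocallyClosed_singleton_iff (hr i)]
    exact h _ ((isSeparablePoint_iff_of_isEmbedding hκ hT (hf i) (hr i) q).2 hq)
  · intro h P hP
    obtain ⟨i, hi⟩ := Set.mem_iUnion.1 (hcover ▸ Set.mem_univ P)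
    rw [← hrange i] at hi
    obtain ⟨q, rfl⟩ := hi
    rw [(hf i).isLocallyClosed_singleton_iff (hr i)]
    exact h i q ((isSeparablePoint_iff_of_isEmbedding hκ hT (hf i) (hr i) q).1 hP)
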